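/- Let 0 < α ≤ 1/2, let f ∈ 𝒜_α be outer with ‖f‖_{𝒜_α} ≤ 1, let 1 < ρ ≤ 2, let Γ be a union of component arcs of 𝕋\E_f, and let γ = (a,b) be a component arc of 𝕋\E_f of arclength < 1/2, with d(z) ≤ 1/2 for z ∈ Δ_γ². For z ∈ Δ_γ²² set μ_z := 1 − 8|log d(z)|/a_γ(z), and for r < 1 set γ_r := {z ∈ 𝔻 : |z| = r, z/|z| ∈ γ}. Then for every r < 1, ∫_{γ_r ∩ Δ_γ²²} |f(re^{it}) − f(μ_{re^{it}} re^{it})|^{2ρ} a_γ(re^{it})² r dt ≤ C_ρ (1−r)^{ε_ρ − 1} ∫_{Δ_γ} |f'(w)|² dA(w), where ε_ρ := α(ρ−1) and C_ρ > 0 depends only on ρ and α. -/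

import Mathlib

open Complex MeasureTheory Set Metric Filter
open scoped ENNReal Classical

noncomputable section

/-- The open unit disc in `ℂ`. -/
def uDisc : Set ℂ := Metric.ball 0 1

/-- The unit circle in `ℂ`. -/
def uCircle : Set ℂ := Metric.sphere (0 : ℂ) 1

/-- `f` is analytic on the open unit disc and continuous on the closed unit disc. -/
def IsDiscReg (f : ℂ → ℂ) : Prop :=
  DifferentiableOn ℂ f uDisc ∧ ContinuousOn f (Metric.closedBall 0 1)

/-- The little-o Lipschitz condition of order `α` on the closed unit disc:
`|f z - f w| = o(|z-w|^α)` as `|z - w| → 0`. -/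
def LittleLip (α : ℝ) (f : ℂ → ℂ) : Prop :=
  ∀ ε > 0, ∃ δ > 0, ∀ z ∈ Metric.closedBall (0 : ℂ) 1, ∀ w ∈ Metric.closedBall (0 : ℂ) 1,
    ‖z - w‖ < δ → ‖f z - f w‖ ≤ ε * ‖z - w‖ ^ α

/-- Membership in `lip_α`. -/
def MemLip (α : ℝ) (f : ℂ → ℂ) : Prop := IsDiscReg f ∧ LittleLip α f

/-- The Dirichlet integral `D(f) = ∫_𝔻 |f'|² dA` with respect to the normalized
area measure `dA = (1/π)·(Lebesgue)`. -/
def dirInt (f : ℂ → ℂ) : ℝ := (1 / Real.pi) * ∫ z in uDisc, ‖deriv f z‖ ^ 2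

/-- Membership in the Dirichlet space `𝒟`. -/
def MemDir (f : ℂ → ℂ) : Prop :=
  DifferentiableOn ℂ f uDisc ∧ IntegrableOn (fun z => ‖deriv f z‖ ^ 2) uDisc

/-- Sup norm over the unit disc. -/
def supNorm (f : ℂ → ℂ) : ℝ := sSup ((fun z => ‖f z‖) '' uDisc)

/-- The `lip_α` norm `‖f‖_α = ‖f‖_∞ + sup_{z∈𝔻} (1-|z|)^{1-α}|f'(z)|`. -/
def lipNorm (α : ℝ) (f : ℂ → ℂ) : ℝ :=
  supNorm f + sSup ((fun z => (1 - ‖z‖) ^ (1 - α) * ‖deriv f z‖) '' uDisc)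

/-- The `𝒜_α` norm `‖f‖_{𝒜_α} = ‖f‖_α + D(f)^{1/2}`. -/
def ANorm (α : ℝ) (f : ℂ → ℂ) : ℝ := lipNorm α f + Real.sqrt (dirInt f)

/-- Membership in `𝒜_α = 𝒟 ∩ lip_α`. -/
def MemA (α : ℝ) (f : ℂ → ℂ) : Prop := MemDir f ∧ MemLip α f

/-- A closed ideal of the Banach algebra `𝒜_α`, encoded as a set of functions `ℂ → ℂ`
(two functions agreeing on the closed disc represent the same element of `𝒜_α`). -/
structure IsClosedIdeal (α : ℝ) (J : Set (ℂ → ℂ)) : Prop where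
  mem_A : ∀ f ∈ J, MemA α f
  zero_mem : (0 : ℂ → ℂ) ∈ J
  add_mem : ∀ f ∈ J, ∀ g ∈ J, f + g ∈ J
  smul_mem : ∀ (c : ℂ), ∀ f ∈ J, c • f ∈ J
  mul_mem : ∀ f ∈ J, ∀ g : ℂ → ℂ, MemA α g → f * g ∈ J
  ext_mem : ∀ f ∈ J, ∀ g : ℂ → ℂ, MemA α g →
    (∀ z ∈ Metric.closedBall (0 : ℂ) 1, g z = f z) → g ∈ J
  closed : ∀ (F : ℕ → ℂ → ℂ) (f : ℂ → ℂ), (∀ n, F n ∈ J) → MemA α f →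
    Tendsto (fun n => ANorm α (F n - f)) atTop (nhds 0) → f ∈ J

/-- The boundary zero set `E_f = {ξ ∈ 𝕋 : f ξ = 0}`. -/
def bZeros (f : ℂ → ℂ) : Set ℂ := {ξ | ξ ∈ uCircle ∧ f ξ = 0}

/-- An inner function: bounded analytic on `𝔻` with radial limits of modulus `1`
at almost every point of `𝕋`. -/
def IsInner (U : ℂ → ℂ) : Prop :=
  DifferentiableOn ℂ U uDisc ∧ (∀ z ∈ uDisc, ‖U z‖ ≤ 1) ∧
    ∀ᵐ θ : ℝ, Tendsto (fun r : ℝ => ‖U ((r : ℂ) * Complex.exp ((θ : ℂ) * Complex.I))‖)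
      (nhdsWithin 1 (Set.Iio 1)) (nhds 1)

/-- The Schwarz/Herglotz kernel `(e^{iθ}+z)/(e^{iθ}-z)`. -/
def circleKernel (z : ℂ) (θ : ℝ) : ℂ :=
  (Complex.exp ((θ : ℂ) * Complex.I) + z) / (Complex.exp ((θ : ℂ) * Complex.I) - z)

/-- `f` is an outer function. -/
def IsOuter (f : ℂ → ℂ) : Prop :=
  IsDiscReg f ∧ (∃ z ∈ uDisc, f z ≠ 0) ∧
    ∀ z ∈ uDisc, f z = Complex.exp ((1 / (2 * (Real.pi : ℂ))) *
      ∫ θ in (0:ℝ)..(2 * Real.pi),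
        circleKernel z θ * (Real.log ‖f (Complex.exp ((θ : ℂ) * Complex.I))‖ : ℂ))

/-- The outer power `f^ρ`, the outer function with boundary modulus `|f|^ρ`. -/
def outerPow (f : ℂ → ℂ) (ρ : ℝ) (z : ℂ) : ℂ :=
  Complex.exp (((ρ : ℂ) / (2 * (Real.pi : ℂ))) *
    ∫ θ in (0:ℝ)..(2 * Real.pi),
      circleKernel z θ * (Real.log ‖f (Complex.exp ((θ : ℂ) * Complex.I))‖ : ℂ))

/-- The set of angles in `[0, 2π)` whose corresponding point of the circle lies in `A`. -/
def angSet (A : Set ℂ) : Set ℝ :=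
  {θ | θ ∈ Set.Ico (0 : ℝ) (2 * Real.pi) ∧ Complex.exp ((θ : ℂ) * Complex.I) ∈ A}

/-- The outer factor `f_Γ` associated with a boundary set `Γ ⊆ 𝕋`. -/
def outerPart (f : ℂ → ℂ) (Γ : Set ℂ) (z : ℂ) : ℂ :=
  Complex.exp ((1 / (2 * (Real.pi : ℂ))) *
    ∫ θ in angSet Γ, circleKernel z θ * (Real.log ‖f (Complex.exp ((θ : ℂ) * Complex.I))‖ : ℂ))

/-- `𝕋 \ E_f`, the set of boundary points where `f` does not vanish. -/
def offZeros (f : ℂ → ℂ) : Set ℂ := {ξ | ξ ∈ uCircle ∧ f ξ ≠ 0}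

/-- `γ` is a component arc (connected component) of `𝕋 \ E_f`. -/
def IsCompArc (f : ℂ → ℂ) (γ : Set ℂ) : Prop :=
  ∃ x ∈ offZeros f, γ = connectedComponentIn (offZeros f) x

/-- `Γ` is a union of component arcs of `𝕋 \ E_f`. -/
def IsArcUnion (f : ℂ → ℂ) (Γ : Set ℂ) : Prop :=
  Γ ⊆ offZeros f ∧ ∀ x ∈ Γ, connectedComponentIn (offZeros f) x ⊆ Γ

/-- The sector `Δ_γ = {z ∈ 𝔻 : z/|z| ∈ γ}`. -/
def discSector (γ : Set ℂ) : Set ℂ := {z | z ∈ uDisc ∧ ((‖z‖ : ℂ))⁻¹ * z ∈ γ}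

/-- Lower integral of `g` over `S` with respect to the normalized area measure
`dA = (1/π)·(Lebesgue)`. -/
def nlint (S : Set ℂ) (g : ℂ → ℝ) : ℝ≥0∞ :=
  ENNReal.ofReal (1 / Real.pi) * ∫⁻ z in S, ENNReal.ofReal (g z)

/-- `d(z) = min(|z-a|, |z-b|)`, distance to the endpoints of the arc `γ = (a,b)`. -/
def dd (a b z : ℂ) : ℝ := min ‖z - a‖ ‖z - b‖

/-- `Λ_γ`: equals `Γ` if `γ ⊄ Γ`, and `𝕋 \ Γ` if `γ ⊆ Γ`. -/
def lamSet (Γ γ : Set ℂ) : Set ℂ := if γ ⊆ Γ then uCircle \ Γ else Γ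

/-- The function `a_γ(z) = (1/2π)∫_{Λ_γ} (−log|f(e^{iθ})|)/|e^{iθ}−z|² dθ`. -/
def aFun (f : ℂ → ℂ) (Γ γ : Set ℂ) (z : ℂ) : ℝ :=
  (1 / (2 * Real.pi)) * ∫ θ in angSet (lamSet Γ γ),
    (-(Real.log ‖f (Complex.exp ((θ : ℂ) * Complex.I))‖)) /
      ‖Complex.exp ((θ : ℂ) * Complex.I) - z‖ ^ 2

/-- `Δ_γ¹ = {z ∈ Δ_γ : d(z) < 2(1−|z|)}`. -/
def sector1 (a b : ℂ) (γ : Set ℂ) : Set ℂ :=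
  {z | z ∈ discSector γ ∧ dd a b z < 2 * (1 - ‖z‖)}

/-- `Δ_γ² = {z ∈ Δ_γ : d(z) ≥ 2(1−|z|)}`. -/
def sector2 (a b : ℂ) (γ : Set ℂ) : Set ℂ :=
  {z | z ∈ discSector γ ∧ 2 * (1 - ‖z‖) ≤ dd a b z}

/-- `Δ_γ²¹ = {z ∈ Δ_γ² : a_γ(z) ≤ 8|log d(z)|/d(z)}`. -/
def sector21 (f : ℂ → ℂ) (Γ γ : Set ℂ) (a b : ℂ) : Set ℂ :=
  {z | z ∈ sector2 a b γ ∧ aFun f Γ γ z ≤ 8 * |Real.log (dd a b z)| / dd a b z}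

/-- `Δ_γ²² = {z ∈ Δ_γ² : 8|log d(z)|/d(z) < a_γ(z) < 8|log d(z)|/(1−|z|)}`. -/
def sector22 (f : ℂ → ℂ) (Γ γ : Set ℂ) (a b : ℂ) : Set ℂ :=
  {z | z ∈ sector2 a b γ ∧ 8 * |Real.log (dd a b z)| / dd a b z < aFun f Γ γ z ∧
    aFun f Γ γ z < 8 * |Real.log (dd a b z)| / (1 - ‖z‖)}

/-- `Δ_γ²³ = {z ∈ Δ_γ² : a_γ(z) ≥ 8|log d(z)|/(1−|z|)}`. -/
def sector23 (f : ℂ → ℂ) (Γ γ : Set ℂ) (a b : ℂ) : Set ℂ :=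
  {z | z ∈ sector2 a b γ ∧ 8 * |Real.log (dd a b z)| / (1 - ‖z‖) ≤ aFun f Γ γ z}

/-- `μ_z = 1 − 8|log d(z)|/a_γ(z)`. -/
def muOf (f : ℂ → ℂ) (Γ γ : Set ℂ) (a b : ℂ) (z : ℂ) : ℝ :=
  1 - 8 * |Real.log (dd a b z)| / aFun f Γ γ z

/-- The tail union `Γ_m = ⋃_{p ≥ m} γ_p`. -/
def tailUnion (γ : ℕ → Set ℂ) (m : ℕ) : Set ℂ := ⋃ p ∈ Set.Ici m, γ p

end

theorem MemLip.bddAbove_deriv {α : ℝ} {f : ℂ → ℂ} (hα1 : α < 1) (hf : MemLip α f) :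
    BddAbove ((fun z => (1 - ‖z‖) ^ (1 - α) * ‖deriv f z‖) '' uDisc) := by
  obtain ⟨⟨hd, -⟩, hl⟩ := hf
  obtain ⟨δ, hδ, hL⟩ := hl 1 one_pos
  refine ⟨(2 + 2 / δ) ^ (1 - α), ?_⟩
  rintro _ ⟨z, hz, rfl⟩
  have hz1 : ‖z‖ < 1 := by simpa [uDisc] using hz
  set s := 1 - ‖z‖ with hs
  have hs0 : 0 < s := by linarith
  have hs1 : s ≤ 1 := by have := norm_nonneg z; linarith
  set R := min s δ / 2 with hR
  have hR0 : 0 < R := by positivity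
  have hRs : R < s := by have := min_le_left s δ; linarith
  have hRδ : R < δ := by have := min_le_right s δ; linarith
  have hsub : closedBall z R ⊆ uDisc := by
    intro w hw
    have h1 : ‖w - z‖ ≤ R := by simpa [dist_eq_norm] using hw
    have h2 : ‖w‖ ≤ ‖w - z‖ + ‖z‖ := by simpa using norm_add_le (w - z) z
    simp only [uDisc, mem_ball_zero_iff]
    linarith
  have hcl : uDisc ⊆ closedBall (0 : ℂ) 1 := ball_subset_closedBall
  have hdc : DiffContOnCl ℂ (fun w => f w - f z) (ball z R) := by
    apply DifferentiableOn.diffContOnCl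
    rw [closure_ball z hR0.ne']
    exact (hd.mono hsub).sub_const _
  have hderiv : ‖deriv f z‖ ≤ R ^ α / R := by
    rw [← deriv_sub_const (f := f) (f z)]
    refine norm_deriv_le_of_forall_mem_sphere_norm_le hR0 hdc fun w hw => ?_
    have hw' : ‖w - z‖ = R := by simpa [dist_eq_norm] using hw
    have := hL w (hcl (hsub (sphere_subset_closedBall hw))) z (hcl hz) (by rw [hw']; exact hRδ)
    rwa [hw', one_mul] at this
  have hRα : R ^ α / R = (R ^ (1 - α))⁻¹ := by
    rw [← Real.rpow_neg hR0.le, ← Real.rpow_sub_one hR0.ne']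
    congr 1
    ring
  have hsR : s / R ≤ 2 + 2 / δ := by
    rw [div_le_iff₀ hR0, hR]
    rcases le_total s δ with h | h
    · rw [min_eq_left h]
      have : 0 ≤ 2 / δ * (s / 2) := by positivity
      linarith
    · rw [min_eq_right h]
      have : 2 / δ * (δ / 2) = 1 := by field_simp
      linarith
  calc s ^ (1 - α) * ‖deriv f z‖ ≤ s ^ (1 - α) * (R ^ (1 - α))⁻¹ := by
        rw [← hRα]; gcongr
    _ = (s / R) ^ (1 - α) := by rw [Real.div_rpow hs0.le hR0.le, div_eq_mul_inv]
    _ ≤ (2 + 2 / δ) ^ (1 - α) := by gcongr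

theorem norm_deriv_le_of_ANorm_le_one {α : ℝ} {f : ℂ → ℂ} (hα1 : α < 1) (hf : MemLip α f)
    (hN : ANorm α f ≤ 1) {z : ℂ} (hz : z ∈ uDisc) : ‖deriv f z‖ ≤ (1 - ‖z‖) ^ (α - 1) := by
  have h1 : 0 ≤ supNorm f := by
    apply Real.sSup_nonneg
    rintro _ ⟨w, -, rfl⟩
    exact norm_nonneg _
  have h2 : 0 ≤ Real.sqrt (dirInt f) := Real.sqrt_nonneg _
  have h3 := le_csSup (hf.bddAbove_deriv hα1) (mem_image_of_mem _ hz)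
  have hz1 : 0 < 1 - ‖z‖ := by
    have : ‖z‖ < 1 := by simpa [uDisc] using hz
    linarith
  have h4 : (1 - ‖z‖) ^ (1 - α) * ‖deriv f z‖ ≤ 1 := by
    simp only [ANorm, lipNorm] at hN
    linarith
  rw [← neg_sub 1 α, Real.rpow_neg hz1.le, ← one_div, le_div_iff₀ (by positivity)]
  linarith

theorem lintegral_Ico_eq_of_periodic {φ : ℝ → ℝ≥0∞} (hφ : Function.Periodic φ (2 * Real.pi)) :
    ∫⁻ t in Ico 0 (2 * Real.pi), φ t = ∫⁻ t in Ioo (-Real.pi) Real.pi, φ t := by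
  have h := (isAddFundamentalDomain_Ioc Real.two_pi_pos 0 volume).setLIntegral_eq
    (isAddFundamentalDomain_Ioc Real.two_pi_pos (-Real.pi) volume) φ hφ.map_vadd_zmultiples
  rw [show -Real.pi + 2 * Real.pi = Real.pi by ring, zero_add] at h
  rw [setLIntegral_congr Ico_ae_eq_Ioc, h, setLIntegral_congr Ioo_ae_eq_Ioc]

theorem measurableSet_discSector {γ : Set ℂ} (hγ : MeasurableSet γ) :
    MeasurableSet (discSector γ) := by
  have h : Measurable fun z : ℂ => ((‖z‖ : ℂ))⁻¹ * z := by fun_prop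
  exact measurableSet_ball.inter (h hγ)

theorem measurableSet_angSet {γ : Set ℂ} (hγ : MeasurableSet γ) : MeasurableSet (angSet γ) := by
  have h : Measurable fun t : ℝ => Complex.exp ((t : ℂ) * Complex.I) := by fun_prop
  exact measurableSet_Ico.inter (h hγ)

theorem mem_discSector_mul_exp_iff {γ : Set ℂ} {u : ℝ} (hu : 0 < u) (t : ℝ) :
    (u : ℂ) * Complex.exp ((t : ℂ) * Complex.I) ∈ discSector γ ↔
      u < 1 ∧ Complex.exp ((t : ℂ) * Complex.I) ∈ γ := by
  have hn : ‖(u : ℂ) * Complex.exp ((t : ℂ) * Complex.I)‖ = u := by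
    rw [norm_mul, Complex.norm_exp_ofReal_mul_I, mul_one, Complex.norm_of_nonneg hu.le]
  have hu' : (u : ℂ) ≠ 0 := by exact_mod_cast hu.ne'
  simp only [discSector, mem_ofPred_eq, uDisc, mem_ball_zero_iff, hn]
  rw [inv_mul_cancel_left₀ hu']

theorem lintegral_discSector {γ : Set ℂ} (hγ : MeasurableSet γ) {g : ℂ → ℝ≥0∞}
    (hg : Measurable g) :
    ∫⁻ z in discSector γ, g z = ∫⁻ t in angSet γ, ∫⁻ u in Ioo (0 : ℝ) 1,
      ENNReal.ofReal u * g ((u : ℂ) * Complex.exp ((t : ℂ) * Complex.I)) := by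
  set e : ℝ → ℂ := fun t => Complex.exp ((t : ℂ) * Complex.I) with he
  have hme : Measurable e := by fun_prop
  set φ : ℝ → ℝ≥0∞ := fun t => (e ⁻¹' γ).indicator
    (fun t => ∫⁻ u in Ioo (0 : ℝ) 1, ENNReal.ofReal u * g ((u : ℂ) * e t)) t with hφ
  have heper : Function.Periodic e (2 * Real.pi) := by
    intro t
    simp only [he]
    push_cast
    rw [add_mul, Complex.exp_periodic]
  have hper : Function.Periodic φ (2 * Real.pi) := by
    intro t
    simp only [hφ, indicator, mem_preimage, heper t]
  have hrhs : ∫⁻ t in angSet γ, ∫⁻ u in Ioo (0 : ℝ) 1, ENNReal.ofReal u * g ((u : ℂ) * e t) =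
      ∫⁻ t in Ico 0 (2 * Real.pi), φ t := by
    rw [hφ, setLIntegral_indicator (hme hγ), inter_comm]
    rfl
  rw [hrhs, lintegral_Ico_eq_of_periodic hper, ← lintegral_indicator (measurableSet_discSector hγ),
    ← Complex.lintegral_comp_polarCoord_symm, polarCoord_target, Measure.volume_eq_prod,
    setLIntegral_prod_symm]
  · refine setLIntegral_congr_fun measurableSet_Ioo fun t _ => ?_
    have hrw : ∀ u ∈ Ioi (0 : ℝ), ENNReal.ofReal u •
        (discSector γ).indicator g (Complex.polarCoord.symm (u, t)) =
        (Iio (1 : ℝ)).indicator (fun u => (e ⁻¹' γ).indicator (fun t =>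
          ENNReal.ofReal u * g ((u : ℂ) * e t)) t) u := by
      intro u hu
      have h1 : Complex.polarCoord.symm (u, t) = (u : ℂ) * e t := by
        simp [Complex.polarCoord_symm_apply, he, Complex.exp_mul_I]
      have h2 := mem_discSector_mul_exp_iff (γ := γ) (mem_Ioi.1 hu) t
      rw [h1]
      simp only [indicator, mem_preimage, mem_Iio]
      by_cases h3 : u < 1 <;> by_cases h4 : e t ∈ γ <;> simp_all
    rw [setLIntegral_congr_fun measurableSet_Ioi hrw, setLIntegral_indicator measurableSet_Iio,
      inter_comm, Ioi_inter_Iio]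
    by_cases h4 : e t ∈ γ <;> simp [hφ, h4]
  · have h1 : Measurable fun p : ℝ × ℝ => Complex.polarCoord.symm p := by
      simp only [Complex.polarCoord_symm_apply]
      fun_prop
    have h2 := (hg.indicator (measurableSet_discSector hγ)).comp h1
    exact ((by fun_prop : Measurable fun p : ℝ × ℝ => ENNReal.ofReal p.1).mul h2).aemeasurable

theorem sq_intervalIntegral_le {g : ℝ → ℝ} {p q : ℝ} (hpq : p < q)
    (hg : ContinuousOn g (uIcc p q)) :
    (∫ u in p..q, g u) ^ 2 ≤ (q - p) * ∫ u in p..q, g u ^ 2 := by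
  set J := ∫ u in p..q, g u with hJ
  set m := J / (q - p) with hm
  have hL : 0 < q - p := sub_pos.2 hpq
  have hi : IntervalIntegrable g volume p q := hg.intervalIntegrable
  have hi2 : IntervalIntegrable (fun u => g u ^ 2) volume p q := (hg.pow 2).intervalIntegrable
  have h0 : 0 ≤ ∫ u in p..q, (g u - m) ^ 2 :=
    intervalIntegral.integral_nonneg hpq.le fun u _ => sq_nonneg _
  have h1 : ∫ u in p..q, (g u - m) ^ 2 = (∫ u in p..q, g u ^ 2) - 2 * m * J + m ^ 2 * (q - p) := by
    have : ∀ u, (g u - m) ^ 2 = g u ^ 2 - 2 * m * g u + m ^ 2 := fun u => by ring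
    simp only [this]
    rw [intervalIntegral.integral_add (hi2.sub (hi.const_mul _)) (by simp),
      intervalIntegral.integral_sub hi2 (hi.const_mul _), intervalIntegral.integral_const_mul,
      intervalIntegral.integral_const, smul_eq_mul]
    ring
  have h2 : J = m * (q - p) := by rw [hm]; field_simp
  rw [h1] at h0
  have h3 : m ^ 2 * (q - p) ≤ ∫ u in p..q, g u ^ 2 := by
    rw [h2] at h0; linarith
  calc J ^ 2 = (q - p) * (m ^ 2 * (q - p)) := by rw [h2]; ring
    _ ≤ _ := by gcongr

theorem integral_one_sub_rpow_le {α p q : ℝ} (hα : 0 < α) (hpq : p ≤ q) (hq : q < 1) :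
    IntervalIntegrable (fun u : ℝ => (1 - u) ^ (α - 1)) volume p q ∧
      ∫ u in p..q, (1 - u) ^ (α - 1) ≤ (1 - p) ^ α / α := by
  have hpos : ∀ u ∈ uIcc p q, 0 < 1 - u := by
    intro u hu
    rw [uIcc_of_le hpq] at hu
    linarith [hu.2]
  have hint : IntervalIntegrable (fun u : ℝ => (1 - u) ^ (α - 1)) volume p q := by
    apply ContinuousOn.intervalIntegrable
    exact (by fun_prop : ContinuousOn (fun u : ℝ => 1 - u) (uIcc p q)).rpow_const
      fun u hu => Or.inl (hpos u hu).ne'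
  refine ⟨hint, ?_⟩
  have hderiv : ∀ u ∈ uIcc p q,
      HasDerivAt (fun u : ℝ => -((1 - u) ^ α / α)) ((1 - u) ^ (α - 1)) u := by
    intro u hu
    have h := ((((hasDerivAt_id u).const_sub 1).rpow_const (p := α)
      (Or.inl (hpos u hu).ne')).div_const α).neg
    convert! h using 1
    simp only [id]
    field_simp
  rw [intervalIntegral.integral_eq_sub_of_hasDerivAt hderiv hint]
  have : 0 ≤ (1 - q) ^ α / α := div_nonneg (Real.rpow_nonneg (by linarith) _) hα.le
  linarith

section Radial

variable {f : ℂ → ℂ} {ζ : ℂ} {p q : ℝ}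

theorem ofReal_mul_mem_uDisc (hζ : ‖ζ‖ = 1) (hp : 0 ≤ p) (hq : q < 1) {u : ℝ}
    (hu : u ∈ Icc p q) : (u : ℂ) * ζ ∈ uDisc := by
  rw [uDisc, mem_ball_zero_iff, norm_mul, hζ, mul_one, Complex.norm_of_nonneg (hp.trans hu.1)]
  exact hu.2.trans_lt hq

theorem continuousOn_norm_deriv_radial (hf : DifferentiableOn ℂ f uDisc) (hζ : ‖ζ‖ = 1)
    (hp : 0 ≤ p) (hpq : p ≤ q) (hq : q < 1) :
    ContinuousOn (fun u : ℝ => ‖deriv f ((u : ℂ) * ζ)‖) (uIcc p q) := by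
  refine ((hf.deriv isOpen_ball).continuousOn.comp (by fun_prop) ?_).norm
  intro u hu
  rw [uIcc_of_le hpq] at hu
  exact ofReal_mul_mem_uDisc hζ hp hq hu

theorem norm_sub_le_integral_norm_deriv (hf : DifferentiableOn ℂ f uDisc) (hζ : ‖ζ‖ = 1)
    (hp : 0 ≤ p) (hpq : p ≤ q) (hq : q < 1) :
    ‖f ((q : ℂ) * ζ) - f ((p : ℂ) * ζ)‖ ≤ ∫ u in p..q, ‖deriv f ((u : ℂ) * ζ)‖ := by
  have hmem : ∀ u ∈ uIcc p q, (u : ℂ) * ζ ∈ uDisc := by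
    intro u hu
    rw [uIcc_of_le hpq] at hu
    exact ofReal_mul_mem_uDisc hζ hp hq hu
  have hcont : ContinuousOn (fun u : ℝ => deriv f ((u : ℂ) * ζ) * ζ) (uIcc p q) :=
    ((hf.deriv isOpen_ball).continuousOn.comp (by fun_prop) hmem).mul_const ζ
  have hderiv : ∀ u ∈ uIcc p q, HasDerivAt (fun u : ℝ => f ((u : ℂ) * ζ))
      (deriv f ((u : ℂ) * ζ) * ζ) u := by
    intro u hu
    have h1 : HasDerivAt (fun u : ℝ => (u : ℂ) * ζ) ζ u := by
      simpa using (Complex.ofRealCLM.hasDerivAt (x := u)).mul_const ζ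
    exact ((hf.differentiableAt (isOpen_ball.mem_nhds (hmem u hu))).hasDerivAt.comp u h1)
  rw [← intervalIntegral.integral_eq_sub_of_hasDerivAt hderiv hcont.intervalIntegrable]
  refine (intervalIntegral.norm_integral_le_integral_norm hpq).trans_eq ?_
  simp only [norm_mul, hζ, mul_one]

theorem norm_sub_sq_le_integral_norm_deriv_sq (hf : DifferentiableOn ℂ f uDisc) (hζ : ‖ζ‖ = 1)
    (hp : 0 ≤ p) (hpq : p < q) (hq : q < 1) :
    ‖f ((q : ℂ) * ζ) - f ((p : ℂ) * ζ)‖ ^ 2 ≤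
      (q - p) * ∫ u in p..q, ‖deriv f ((u : ℂ) * ζ)‖ ^ 2 := by
  refine le_trans ?_
    (sq_intervalIntegral_le hpq (continuousOn_norm_deriv_radial hf hζ hp hpq.le hq))
  gcongr
  exact norm_sub_le_integral_norm_deriv hf hζ hp hpq.le hq

theorem norm_sub_le_of_norm_deriv_le {α : ℝ} (hα : 0 < α) (hf : DifferentiableOn ℂ f uDisc)
    (hfα : ∀ z ∈ uDisc, ‖deriv f z‖ ≤ (1 - ‖z‖) ^ (α - 1)) (hζ : ‖ζ‖ = 1)
    (hp : 0 ≤ p) (hpq : p ≤ q) (hq : q < 1) :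
    ‖f ((q : ℂ) * ζ) - f ((p : ℂ) * ζ)‖ ≤ (1 - p) ^ α / α := by
  obtain ⟨hint, hle⟩ := integral_one_sub_rpow_le hα hpq hq
  refine (norm_sub_le_integral_norm_deriv hf hζ hp hpq hq).trans (le_trans ?_ hle)
  refine intervalIntegral.integral_mono_on hpq
    (continuousOn_norm_deriv_radial hf hζ hp hpq hq).intervalIntegrable hint fun u hu => ?_
  have h := hfα _ (ofReal_mul_mem_uDisc hζ hp hq hu)
  rwa [norm_mul, hζ, mul_one, Complex.norm_of_nonneg (hp.trans hu.1)] at h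

theorem ofReal_integral_norm_deriv_sq_le (hf : DifferentiableOn ℂ f uDisc) (hζ : ‖ζ‖ = 1)
    (hp : 3 / 8 ≤ p) (hpq : p ≤ q) (hq : q < 1) :
    ENNReal.ofReal (∫ u in p..q, ‖deriv f ((u : ℂ) * ζ)‖ ^ 2) ≤
      ENNReal.ofReal (8 / 3) * ∫⁻ u in Ioo (0 : ℝ) 1,
        ENNReal.ofReal u * ENNReal.ofReal (‖deriv f ((u : ℂ) * ζ)‖ ^ 2) := by
  have hc : ContinuousOn (fun u : ℝ => ‖deriv f ((u : ℂ) * ζ)‖ ^ 2) (uIcc p q) :=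
    (continuousOn_norm_deriv_radial hf hζ (by linarith) hpq hq).pow 2
  have hi := (intervalIntegrable_iff_integrableOn_Ioc_of_le (μ := volume) hpq).1
    hc.intervalIntegrable
  rw [intervalIntegral.integral_of_le hpq, ofReal_integral_eq_lintegral_ofReal hi
    (ae_of_all _ fun u => sq_nonneg _), ← lintegral_const_mul' _ _ ENNReal.ofReal_ne_top]
  refine (setLIntegral_mono' measurableSet_Ioc fun u hu => ?_).trans
    (lintegral_mono_set (Ioc_subset_Ioo_right hq |>.trans (Ioo_subset_Ioo_left (by linarith))))
  have hu0 : 3 / 8 ≤ u := hp.trans hu.1.le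
  rw [← ENNReal.ofReal_mul (by linarith), ← ENNReal.ofReal_mul (by norm_num)]
  apply ENNReal.ofReal_le_ofReal
  nlinarith [sq_nonneg ‖deriv f ((u : ℂ) * ζ)‖]

end Radial

theorem sq_abs_log_mul_rpow_le {ε d : ℝ} (hε : 0 < ε) (hd0 : 0 < d) (hd1 : d ≤ 1) :
    |Real.log d| ^ 2 * d ^ ε ≤ (2 / ε) ^ 2 := by
  have h1 := Real.log_le_rpow_div (inv_nonneg.2 hd0.le) (half_pos hε)
  rw [Real.log_inv, Real.inv_rpow hd0.le] at h1
  rw [abs_of_nonpos (Real.log_nonpos hd0.le hd1)]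
  have h0 : 0 ≤ -Real.log d := neg_nonneg.2 (Real.log_nonpos hd0.le hd1)
  have h2 : d ^ ε = (d ^ (ε / 2)) ^ 2 := by
    rw [← Real.rpow_natCast, ← Real.rpow_mul hd0.le]
    norm_num
  rw [h2, ← mul_pow]
  have h3 : 0 < d ^ (ε / 2) := by positivity
  gcongr
  calc -Real.log d * d ^ (ε / 2) ≤ (d ^ (ε / 2))⁻¹ / (ε / 2) * d ^ (ε / 2) := by gcongr
    _ = 2 / ε := by field_simp

theorem rpow_mul_sq_le_of_holder_of_sq_le {α ρ B I s h d a : ℝ} (hα : 0 < α) (hρ : 1 < ρ)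
    (hερ : α * (ρ - 1) ≤ 1) (hB : 0 ≤ B) (hI : 0 ≤ I) (hs : 0 < s) (hsh : s ≤ h) (hhd : h ≤ d)
    (hd : d ≤ 1) (hBI : B ^ 2 ≤ h * I) (hBh : B ≤ (2 * h) ^ α / α)
    (hah : a * h = 8 * |Real.log d|) :
    B ^ (2 * ρ) * a ^ 2 ≤ 64 * (2 ^ α / α) ^ (2 * (ρ - 1)) * (2 / (α * (ρ - 1))) ^ 2 *
      s ^ (α * (ρ - 1) - 1) * I := by
  have hh : 0 < h := hs.trans_le hsh
  have hd0 : 0 < d := hh.trans_le hhd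
  set ε := α * (ρ - 1) with hε
  have hε0 : 0 < ε := mul_pos hα (by linarith)
  have hBρ : B ^ (2 * ρ) = B ^ 2 * B ^ (2 * (ρ - 1)) := by
    rw [show 2 * ρ = 2 + 2 * (ρ - 1) by ring, Real.rpow_add_of_nonneg hB (by norm_num)
      (by linarith), Real.rpow_two]
  set K := (2 ^ α / α) ^ (2 * (ρ - 1)) with hK
  have hK0 : 0 ≤ K := by positivity
  have hBK : B ^ (2 * (ρ - 1)) ≤ K * h ^ (2 * ε) := by
    calc B ^ (2 * (ρ - 1)) ≤ ((2 * h) ^ α / α) ^ (2 * (ρ - 1)) := by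
          gcongr
      _ = K * h ^ (2 * ε) := by
          rw [Real.mul_rpow (by norm_num) hh.le, mul_div_right_comm,
            Real.mul_rpow (by positivity) (by positivity), ← Real.rpow_mul hh.le, hK, hε]
          ring_nf
  have ha : a = 8 * |Real.log d| / h := by rw [← hah]; field_simp
  have hhs : h ^ (ε - 1) ≤ s ^ (ε - 1) :=
    Real.rpow_le_rpow_of_nonpos hs hsh (by linarith)
  have hlog : |Real.log d| ^ 2 * h ^ ε ≤ (2 / ε) ^ 2 :=
    le_trans (by gcongr) (sq_abs_log_mul_rpow_le hε0 hd0 hd)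
  have hsplit : h ^ (2 * ε) = h ^ ε * h ^ (ε - 1) * h := by
    rw [← Real.rpow_add hh, ← Real.rpow_add_one hh.ne']
    ring_nf
  calc B ^ (2 * ρ) * a ^ 2 ≤ (h * I) * (K * h ^ (2 * ε)) * a ^ 2 := by
        rw [hBρ]; gcongr
    _ = 64 * K * (|Real.log d| ^ 2 * h ^ ε) * h ^ (ε - 1) * I := by
        rw [hsplit, ha]; field_simp; ring
    _ ≤ _ := by gcongr

theorem measurableSet_of_closure_eq_insert {γ : Set ℂ} {a b : ℂ}
    (h : closure γ = insert a (insert b γ)) : MeasurableSet γ := by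
  have hγ : γ = closure γ \ (({a, b} : Set ℂ) \ γ) := by
    rw [h]
    ext z
    simp only [Set.mem_sdiff, mem_insert_iff, mem_singleton_iff]
    tauto
  rw [hγ]
  exact isClosed_closure.measurableSet.diff
    ((Set.toFinite {a, b}).subset sdiff_subset).measurableSet

/-- Estimate on circular slices of `Δ_γ²²`:
`∫_{γ_r ∩ Δ_γ²²} |f(re^{it}) − f(μ re^{it})|^{2ρ} a_γ(re^{it})² r dt
  ≤ C_ρ (1−r)^{ε_ρ−1} ‖f'‖²_{L²(Δ_γ)}`, where `ε_ρ = α(ρ−1)`. -/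
theorem circular_slice_est (α ρ : ℝ) (hα0 : 0 < α) (hα1 : α ≤ 1/2) (hρ1 : 1 < ρ) (hρ2 : ρ ≤ 2) :
    ∃ C : ℝ, 0 < C ∧ ∀ (f : ℂ → ℂ) (Γ γ : Set ℂ) (a b : ℂ),
      MemA α f → IsOuter f → ANorm α f ≤ 1 → IsArcUnion f Γ →
      IsCompArc f γ → volume (angSet γ) < ENNReal.ofReal (1/2) →
      a ∈ bZeros f → b ∈ bZeros f → closure γ = insert a (insert b γ) →
      (∀ z ∈ sector2 a b γ, dd a b z ≤ 1/2) →
      ∀ r : ℝ, 0 ≤ r → r < 1 →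
        (∫⁻ t in {t ∈ angSet γ |
            (r : ℂ) * Complex.exp ((t : ℂ) * Complex.I) ∈ sector22 f Γ γ a b},
          ENNReal.ofReal
            (‖f ((r : ℂ) * Complex.exp ((t : ℂ) * Complex.I)) -
                f ((muOf f Γ γ a b ((r : ℂ) * Complex.exp ((t : ℂ) * Complex.I)) : ℂ) *
                  ((r : ℂ) * Complex.exp ((t : ℂ) * Complex.I)))‖ ^ (2 * ρ) *
              (aFun f Γ γ ((r : ℂ) * Complex.exp ((t : ℂ) * Complex.I))) ^ 2 * r)) ≤
          ENNReal.ofReal (C * (1 - r) ^ (α * (ρ - 1) - 1)) *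
            nlint (discSector γ) (fun w => ‖deriv f w‖ ^ 2) := by
  set ε := α * (ρ - 1) with hε
  have hε0 : 0 < ε := mul_pos hα0 (by linarith)
  have hε1 : ε ≤ 1 := by nlinarith
  set K := 64 * (2 ^ α / α) ^ (2 * (ρ - 1)) * (2 / ε) ^ 2 with hK
  have hK0 : 0 < K := by positivity
  refine ⟨Real.pi * (8 / 3) * K, by positivity, ?_⟩
  intro f Γ γ a b hA _ hN _ _ _ _ _ hcl hdd r hr0 hr1
  have hf : DifferentiableOn ℂ f uDisc := hA.1.1
  have hfα : ∀ z ∈ uDisc, ‖deriv f z‖ ≤ (1 - ‖z‖) ^ (α - 1) := fun z hz =>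
    norm_deriv_le_of_ANorm_le_one (by linarith) hA.2 hN hz
  have hγ : MeasurableSet γ := measurableSet_of_closure_eq_insert hcl
  have hs : 0 < 1 - r := by linarith
  set e : ℝ → ℂ := fun t => Complex.exp ((t : ℂ) * Complex.I) with he
  have hen : ∀ t, ‖e t‖ = 1 := fun t => Complex.norm_exp_ofReal_mul_I t
  set g : ℂ → ℝ≥0∞ := fun w => ENNReal.ofReal (‖deriv f w‖ ^ 2) with hg
  have hgm : Measurable g := ((measurable_deriv f).norm.pow_const 2).ennreal_ofReal
  set G : ℝ → ℝ≥0∞ := fun t => ∫⁻ u in Ioo (0 : ℝ) 1, ENNReal.ofReal u * g ((u : ℂ) * e t) with hG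
  have hGm : Measurable G := by
    have h1 : Measurable fun p : ℝ × ℝ => (p.2 : ℂ) * e p.1 := by fun_prop
    exact Measurable.lintegral_prod_right'
      (f := fun p : ℝ × ℝ => ENNReal.ofReal p.2 * g ((p.2 : ℂ) * e p.1))
      ((by fun_prop : Measurable fun p : ℝ × ℝ => ENNReal.ofReal p.2).mul (hgm.comp h1))
  have hpt : ∀ t ∈ {t ∈ angSet γ | (r : ℂ) * e t ∈ sector22 f Γ γ a b},
      ENNReal.ofReal (‖f ((r : ℂ) * e t) -
        f ((muOf f Γ γ a b ((r : ℂ) * e t) : ℂ) * ((r : ℂ) * e t))‖ ^ (2 * ρ) *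
          (aFun f Γ γ ((r : ℂ) * e t)) ^ 2 * r) ≤
        ENNReal.ofReal (8 / 3 * K * (1 - r) ^ (ε - 1)) * G t := by
    rintro t ⟨-, hz2, hlo, hhi⟩
    have hd2 := hz2.2
    have hdle := hdd _ hz2
    have hzn : ‖(r : ℂ) * e t‖ = r := by
      rw [norm_mul, hen, mul_one, Complex.norm_of_nonneg hr0]
    rw [hzn] at hd2 hhi
    rw [muOf]
    set z := (r : ℂ) * e t with hz
    set d := dd a b z
    set A := aFun f Γ γ z
    have hd0 : 0 < d := by linarith
    have hL : 0 < |Real.log d| := abs_pos.2 (Real.log_neg hd0 (by linarith)).ne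
    have hA0 : 0 < A := lt_trans (by positivity) hlo
    set h := 8 * |Real.log d| / A with hh
    have hhd : h < d := by
      rw [div_lt_iff₀ hd0] at hlo
      rw [hh, div_lt_iff₀ hA0]
      linarith
    have hsh : 1 - r < h := by
      rw [lt_div_iff₀ hs] at hhi
      rw [hh, lt_div_iff₀ hA0]
      linarith
    have hr34 : 3 / 4 ≤ r := by linarith
    set p := (1 - h) * r with hp
    have hp38 : 3 / 8 ≤ p := by nlinarith
    have hrp : r - p = h * r := by rw [hp]; ring
    have hpr : p < r := by nlinarith
    have hpz : ((1 - h : ℝ) : ℂ) * z = (p : ℂ) * e t := by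
      rw [hz, hp]; push_cast; ring
    rw [hpz]
    set J := ∫ u in p..r, ‖deriv f ((u : ℂ) * e t)‖ ^ 2 with hJ
    have hJ0 : 0 ≤ J := intervalIntegral.integral_nonneg hpr.le fun u _ => sq_nonneg _
    have hsq := norm_sub_sq_le_integral_norm_deriv_sq hf (hen t) (by linarith) hpr hr1
    have hho := norm_sub_le_of_norm_deriv_le hα0 hf hfα (hen t) (by linarith) hpr.le hr1
    rw [← hz] at hsq hho
    have hmain := rpow_mul_sq_le_of_holder_of_sq_le (a := A) hα0 hρ1 hε1 (norm_nonneg _) hJ0 hs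
      hsh.le hhd.le (by linarith) (hsq.trans (by gcongr; nlinarith))
      (hho.trans (by gcongr <;> nlinarith)) (by rw [hh]; field_simp)
    have hX : 0 ≤ K * (1 - r) ^ (ε - 1) := by positivity
    calc _ ≤ ENNReal.ofReal (K * (1 - r) ^ (ε - 1) * J) :=
          ENNReal.ofReal_le_ofReal ((mul_le_of_le_one_right (by positivity) hr1.le).trans hmain)
      _ = ENNReal.ofReal (K * (1 - r) ^ (ε - 1)) * ENNReal.ofReal J := ENNReal.ofReal_mul hX
      _ ≤ ENNReal.ofReal (K * (1 - r) ^ (ε - 1)) * (ENNReal.ofReal (8 / 3) * G t) := by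
          gcongr
          exact ofReal_integral_norm_deriv_sq_le hf (hen t) hp38 hpr.le hr1
      _ = ENNReal.ofReal (8 / 3 * K * (1 - r) ^ (ε - 1)) * G t := by
          rw [← mul_assoc, ← ENNReal.ofReal_mul hX]
          ring_nf
  calc _ ≤ ∫⁻ t in {t ∈ angSet γ | (r : ℂ) * e t ∈ sector22 f Γ γ a b},
          ENNReal.ofReal (8 / 3 * K * (1 - r) ^ (ε - 1)) * G t :=
        setLIntegral_mono (hGm.const_mul _) hpt
    _ ≤ ∫⁻ t in angSet γ, ENNReal.ofReal (8 / 3 * K * (1 - r) ^ (ε - 1)) * G t :=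
        lintegral_mono_set (sep_subset _ _)
    _ = ENNReal.ofReal (8 / 3 * K * (1 - r) ^ (ε - 1)) * ∫⁻ z in discSector γ, g z := by
        rw [lintegral_const_mul _ hGm, lintegral_discSector hγ hgm]
    _ = _ := by
        have hπ := Real.pi_ne_zero
        rw [nlint, ← mul_assoc (ENNReal.ofReal (Real.pi * (8 / 3) * K * _)),
          ← ENNReal.ofReal_mul (by positivity)]
        congr 2
        field_simp
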